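/- arXiv:math/0611593 — 3 statements merged into one kernel-verified Lean document; each statement's English description precedes it below -/
import Mathlib

section
/- Let X_1, …, X_n be free identically distributed elements of 𝒜 (not necessarily self-adjoint), suppose s² := E(X_1* X_1) > 0, and set γ := √(E((X_1*X_1)²) − (E(X_1*X_1))²) / E(X_1*X_1) (the standard deviation of X_1*X_1 / E(X_1*X_1)). Then ‖Π_n‖ ≥ γ^{1/2} · n^{1/4} · s^{n}, where ‖·‖ is the C*-algebra norm. -/
open scoped ComplexOrder

/-- A family `x : ι → A` is free with respect to the expectation `E`:
whenever consecutive indices differ, centered elements of the generated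
unital *-subalgebras multiply to a centered element. -/
def FreeFamily {A : Type*} [Ring A] [StarRing A] [Algebra ℂ A]
    (E : A →ₗ[ℂ] ℂ) {ι : Type*} (x : ι → A) : Prop :=
  ∀ (m : ℕ) (k : Fin (m + 1) → ι),
    (∀ j : Fin m, k j.castSucc ≠ k j.succ) →
    ∀ a : Fin (m + 1) → A,
      (∀ j, a j ∈ Algebra.adjoin ℂ ({x (k j), star (x (k j))} : Set A)) →
      (∀ j, E (a j) = 0) →
      E (List.ofFn a).prod = 0

/-- Evaluation of a word in `x` and `star x`: `false ↦ x`, `true ↦ star x`. -/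
def wordEval {A : Type*} [Ring A] [StarRing A] (x : A) (w : List Bool) : A :=
  (w.map fun b => if b then star x else x).prod

/-- The ordered product `X 0 * X 1 * ⋯ * X (n-1)`. -/
def prodN {A : Type*} [Ring A] (X : ℕ → A) (n : ℕ) : A :=
  (List.ofFn fun i : Fin n => X i).prod

/-- The reduced words over the indices in `J`: lists of centered elements, each taken from the
*-algebra generated by one `x j` with `j ∈ J`, in which consecutive indices differ. -/
def IsReducedWord {A : Type*} [Ring A] [StarRing A] [Algebra ℂ A]
    (E : A →ₗ[ℂ] ℂ) {ι : Type*} (x : ι → A) (J : Set ι) (L : List (ι × A)) : Prop :=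
  L.IsChain (fun p q => p.1 ≠ q.1) ∧
    ∀ p ∈ L, p.1 ∈ J ∧ p.2 ∈ Algebra.adjoin ℂ ({x p.1, star (x p.1)} : Set A) ∧ E p.2 = 0

/-- The span of the products of all reduced words over `J`, the empty word included. -/
def wordSpan {A : Type*} [Ring A] [StarRing A] [Algebra ℂ A]
    (E : A →ₗ[ℂ] ℂ) {ι : Type*} (x : ι → A) (J : Set ι) : Submodule ℂ A :=
  Submodule.span ℂ {w | ∃ L, IsReducedWord E x J L ∧ (L.map Prod.snd).prod = w}

/-- The span of the products of all nonempty reduced words over `J`. -/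
def centeredWordSpan {A : Type*} [Ring A] [StarRing A] [Algebra ℂ A]
    (E : A →ₗ[ℂ] ℂ) {ι : Type*} (x : ι → A) (J : Set ι) : Submodule ℂ A :=
  Submodule.span ℂ {w | ∃ L, IsReducedWord E x J L ∧ L ≠ [] ∧ (L.map Prod.snd).prod = w}

section Free

variable {A : Type*} [Ring A] [StarRing A] [Algebra ℂ A]
  {E : A →ₗ[ℂ] ℂ} {ι : Type*} {x : ι → A} {J : Set ι}

theorem IsReducedWord.tail {p : ι × A} {L : List (ι × A)} (h : IsReducedWord E x J (p :: L)) :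
    IsReducedWord E x J L :=
  ⟨(List.isChain_cons.1 h.1).2, fun q hq => h.2 q (List.mem_cons_of_mem _ hq)⟩

theorem IsReducedWord.mono {J' : Set ι} (hJ : J ⊆ J') {L : List (ι × A)}
    (h : IsReducedWord E x J L) : IsReducedWord E x J' L :=
  ⟨h.1, fun p hp => ⟨hJ (h.2 p hp).1, (h.2 p hp).2⟩⟩

/-- A reduced word over `J` may be extended on the left by a letter of index outside `J`, which in
turn may be preceded by a reduced word over `J`. -/
theorem IsReducedWord.append_cons {i : ι} (hi : i ∉ J) {a : A}
    (ha : a ∈ Algebra.adjoin ℂ ({x i, star (x i)} : Set A)) (ha0 : E a = 0)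
    {L L' : List (ι × A)} (hL : IsReducedWord E x J L)
    (hL' : IsReducedWord E x (insert i J) L') (hL'' : ∀ p ∈ L'.head?, p.1 ≠ i) :
    IsReducedWord E x (insert i J) (L ++ (i, a) :: L') := by
  refine ⟨List.isChain_append.2 ⟨hL.1, List.isChain_cons.2 ⟨fun p hp => (hL'' p hp).symm, hL'.1⟩,
    ?_⟩, ?_⟩
  · intro p hp q hq
    have hp' := (hL.2 p (List.mem_of_mem_getLast? hp)).1
    simp only [List.head?_cons, Option.mem_def, Option.some.injEq] at hq
    subst hq
    rintro rfl
    exact hi hp'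
  · intro p hp
    rcases List.mem_append.1 hp with hp | hp
    · exact (hL.mono (Set.subset_insert i J)).2 p hp
    · rcases List.mem_cons.1 hp with rfl | hp
      · exact ⟨Set.mem_insert _ _, ha, ha0⟩
      · exact hL'.2 p hp

theorem FreeFamily.apply_word (hfree : FreeFamily E x) {L : List (ι × A)}
    (hL : IsReducedWord E x J L) (hne : L ≠ []) : E (L.map Prod.snd).prod = 0 := by
  obtain ⟨m, hm⟩ : ∃ m, L.length = m + 1 :=
    ⟨L.length - 1, by have := List.length_pos_iff.2 hne; omega⟩
  obtain ⟨f, rfl⟩ : ∃ f : Fin (m + 1) → ι × A, List.ofFn f = L :=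
    ⟨fun j => L.get (j.cast hm.symm), by
      refine List.ext_get (by simp [hm]) fun k h₁ h₂ => by simp [-List.ofFn_succ]⟩
  have h := hfree m (fun j => (f j).1) ?_ (fun j => (f j).2) ?_ ?_
  · simpa [List.map_ofFn, Function.comp_def] using h
  · intro j
    have h := List.isChain_iff_getElem.1 hL.1 j (by simp)
    simpa [-List.ofFn_succ, Fin.succ, Fin.castSucc, Fin.castAdd, Fin.castLE] using h
  · exact fun j => (hL.2 (f j) (List.mem_ofFn.2 ⟨j, rfl⟩)).2.1
  · exact fun j => (hL.2 (f j) (List.mem_ofFn.2 ⟨j, rfl⟩)).2.2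

theorem one_mem_wordSpan : (1 : A) ∈ wordSpan E x J :=
  Submodule.subset_span ⟨[], ⟨by simp, by simp⟩, by simp⟩

theorem exists_centered_of_mem_wordSpan {w : A} (hw : w ∈ wordSpan E x J) :
    ∃ c : ℂ, ∃ r ∈ centeredWordSpan E x J, w = c • 1 + r := by
  refine Submodule.span_induction ?_ ⟨0, 0, zero_mem _, by simp⟩ ?_ ?_ hw
  · rintro w ⟨L, hL, rfl⟩
    rcases eq_or_ne L [] with rfl | hne
    · exact ⟨1, 0, zero_mem _, by simp⟩
    · exact ⟨0, _, Submodule.subset_span ⟨L, hL, hne, rfl⟩, by simp⟩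
  · rintro _ _ _ _ ⟨c, r, hr, rfl⟩ ⟨d, t, ht, rfl⟩
    exact ⟨c + d, r + t, add_mem hr ht, by rw [add_smul]; abel⟩
  · rintro z _ _ ⟨c, r, hr, rfl⟩
    exact ⟨z * c, z • r, Submodule.smul_mem _ _ hr, by rw [smul_add, smul_smul]⟩

/-- The span of the reduced words over `J` is stable under multiplication by elements of the
algebras with index in `J`. -/
theorem mul_mem_wordSpan (hE1 : E 1 = 1) {j : ι} (hj : j ∈ J) {a : A}
    (ha : a ∈ Algebra.adjoin ℂ ({x j, star (x j)} : Set A)) {w : A} (hw : w ∈ wordSpan E x J) :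
    a * w ∈ wordSpan E x J := by
  have key : ∀ c ∈ Algebra.adjoin ℂ ({x j, star (x j)} : Set A), ∀ L, IsReducedWord E x J L →
      (∀ p ∈ L.head?, p.1 ≠ j) → c * (L.map Prod.snd).prod ∈ wordSpan E x J := by
    intro c hc L hL hh
    have hsplit : c * (L.map Prod.snd).prod =
        (((j, c - E c • 1) :: L).map Prod.snd).prod + E c • (L.map Prod.snd).prod := by
      simp [sub_mul]
    rw [hsplit]
    refine add_mem (Submodule.subset_span ⟨_, ⟨List.isChain_cons.2
      ⟨fun p hp => (hh p hp).symm, hL.1⟩, ?_⟩, rfl⟩)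
      (Submodule.smul_mem _ _ (Submodule.subset_span ⟨L, hL, rfl⟩))
    intro p hp
    rcases List.mem_cons.1 hp with rfl | hp
    · exact ⟨hj, sub_mem hc (Subalgebra.smul_mem _ (one_mem _) _), by simp [hE1]⟩
    · exact hL.2 p hp
  refine Submodule.span_induction ?_ (by simp) ?_ ?_ hw
  · rintro w ⟨L, hL, rfl⟩
    rcases L with _ | ⟨⟨k, b⟩, L⟩
    · exact key a ha [] hL (by simp)
    · by_cases hk : k = j
      · subst hk
        have h := key (a * b) (mul_mem ha (hL.2 (k, b) (by simp)).2.1) L hL.tail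
          fun p hp => ((List.isChain_cons.1 hL.1).1 p hp).symm
        simpa [mul_assoc] using h
      · exact key a ha _ hL (by simpa using hk)
  · intro u v _ _ hu hv
    rw [mul_add]
    exact add_mem hu hv
  · intro z u _ hu
    rw [mul_smul_comm]
    exact Submodule.smul_mem _ _ hu

theorem FreeFamily.apply_centered (hfree : FreeFamily E x) {r : A}
    (hr : r ∈ centeredWordSpan E x J) : E r = 0 := by
  have h : centeredWordSpan E x J ≤ LinearMap.ker E := by
    refine Submodule.span_le.2 ?_
    rintro w ⟨L, hL, hne, rfl⟩
    exact hfree.apply_word hL hne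
  exact h hr

theorem IsReducedWord.head?_ne {i : ι} (hi : i ∉ J) {L : List (ι × A)}
    (hL : IsReducedWord E x J L) : ∀ p ∈ L.head?, p.1 ≠ i := by
  rintro p hp rfl
  exact hi (hL.2 p (List.mem_of_mem_head? hp)).1

theorem FreeFamily.apply_mul_centered (hfree : FreeFamily E x) {i : ι} (hi : i ∉ J) {a : A}
    (ha : a ∈ Algebra.adjoin ℂ ({x i, star (x i)} : Set A)) (ha0 : E a = 0) {r : A}
    (hr : r ∈ centeredWordSpan E x J) : E (a * r) = 0 := by
  have h : centeredWordSpan E x J ≤ LinearMap.ker (E ∘ₗ LinearMap.mulLeft ℂ a) := by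
    refine Submodule.span_le.2 ?_
    rintro w ⟨L, hL, -, rfl⟩
    have hword := IsReducedWord.append_cons (L := []) hi ha ha0 ⟨by simp, by simp⟩
      (hL.mono (Set.subset_insert i J)) (hL.head?_ne hi)
    simpa using hfree.apply_word hword (by simp)
  exact h hr

theorem FreeFamily.apply_mul_mul_mul_centered (hfree : FreeFamily E x) {i : ι} (hi : i ∉ J) {a : A}
    (ha : a ∈ Algebra.adjoin ℂ ({x i, star (x i)} : Set A)) (ha0 : E a = 0) {r t : A}
    (hr : r ∈ centeredWordSpan E x J) (ht : t ∈ centeredWordSpan E x J) :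
    E (a * r * a * t) = 0 := by
  refine Submodule.span_induction₂ (p := fun r t _ _ => E (a * r * a * t) = 0) ?_ ?_ ?_ ?_ ?_ ?_ ?_
    hr ht
  · rintro _ _ ⟨L, hL, hne, rfl⟩ ⟨L', hL', -, rfl⟩
    have hword := hL.append_cons hi ha ha0 (hL'.mono (Set.subset_insert i J)) (hL'.head?_ne hi)
    have hhead : ∀ p ∈ (L ++ (i, a) :: L').head?, p.1 ≠ i := by
      rw [List.head?_append_of_ne_nil _ hne]
      exact hL.head?_ne hi
    have hword' := IsReducedWord.append_cons (L := []) hi ha ha0 ⟨by simp, by simp⟩ hword hhead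
    simpa [mul_assoc] using hfree.apply_word hword' (by simp)
  · simp
  · simp
  · intro _ _ _ _ _ _ h₁ h₂
    simp [mul_add, add_mul, h₁, h₂]
  · intro _ _ _ _ _ _ h₁ h₂
    simp [mul_add, h₁, h₂]
  · intro _ _ _ _ _ h
    simp [h]
  · intro _ _ _ _ _ h
    simp [h]

theorem FreeFamily.apply_mul_of_mem_wordSpan (hfree : FreeFamily E x) (hE1 : E 1 = 1)
    {i : ι} (hi : i ∉ J) {a b : A}
    (ha : a ∈ Algebra.adjoin ℂ ({x i, star (x i)} : Set A)) (hb : b ∈ wordSpan E x J) :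
    E (a * b) = E a * E b := by
  obtain ⟨c, r, hr, rfl⟩ := exists_centered_of_mem_wordSpan hb
  have h := hfree.apply_mul_centered hi (a := a - E a • 1)
    (sub_mem ha (Subalgebra.smul_mem _ (one_mem _) _)) (by simp [hE1]) hr
  have hr0 := hfree.apply_centered hr
  simp only [sub_mul, smul_mul_assoc, one_mul, map_sub, map_smul, smul_eq_mul, hr0, mul_zero,
    sub_zero] at h
  simp [mul_add, hE1, h, hr0, mul_comm]

/-- The mixed fourth moment of two free elements. -/
theorem FreeFamily.apply_mul_mul_mul_of_mem_wordSpan (hfree : FreeFamily E x) (hE1 : E 1 = 1)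
    (hEtr : ∀ a b : A, E (a * b) = E (b * a)) {i : ι} (hi : i ∉ J) {a b : A}
    (ha : a ∈ Algebra.adjoin ℂ ({x i, star (x i)} : Set A)) (hb : b ∈ wordSpan E x J)
    (hbb : b * b ∈ wordSpan E x J) :
    E (a * b * a * b) =
      E (a ^ 2) * E b ^ 2 + E a ^ 2 * E (b ^ 2) - E a ^ 2 * E b ^ 2 := by
  obtain ⟨c, r, hr, rfl⟩ := exists_centered_of_mem_wordSpan hb
  obtain ⟨α, a', ha', ha0, rfl⟩ : ∃ α : ℂ, ∃ a' ∈ Algebra.adjoin ℂ ({x i, star (x i)} : Set A),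
      E a' = 0 ∧ a = α • 1 + a' :=
    ⟨E a, a - E a • 1, sub_mem ha (Subalgebra.smul_mem _ (one_mem _) _), by simp [hE1], by simp⟩
  have hRD : r ∈ wordSpan E x J :=
    Submodule.span_mono (by rintro w ⟨L, hL, -, rfl⟩; exact ⟨L, hL, rfl⟩) hr
  have hrr : r * r ∈ wordSpan E x J := by
    have h : r * r = (c • 1 + r) * (c • 1 + r) - (c ^ 2) • 1 - (2 * c) • r := by
      simp only [mul_add, add_mul, smul_mul_assoc, mul_smul_comm, one_mul, mul_one]
      module
    rw [h]
    exact sub_mem (sub_mem hbb (Submodule.smul_mem _ _ one_mem_wordSpan))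
      (Submodule.smul_mem _ _ hRD)
  have hr0 := hfree.apply_centered hr
  have h₁ : E (a' * r) = 0 := hfree.apply_mul_centered hi ha' ha0 hr
  have h₂ : E (r * a') = 0 := by rw [hEtr, h₁]
  have h₃ : E (a' * (r * (a' * r))) = 0 := by
    simpa [mul_assoc] using hfree.apply_mul_mul_mul_centered hi ha' ha0 hr hr
  have h₄ : E (a' * (a' * r)) = 0 := by
    rw [← mul_assoc, hfree.apply_mul_of_mem_wordSpan hE1 hi (mul_mem ha' ha') hRD, hr0, mul_zero]
  have h₅ : E (a' * (r * a')) = 0 := by rw [hEtr, mul_assoc, hEtr, mul_assoc, h₄]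
  have h₆ : E (a' * (r * r)) = 0 := by
    rw [hfree.apply_mul_of_mem_wordSpan hE1 hi ha' hrr, ha0, zero_mul]
  have h₇ : E (r * (a' * r)) = E (a' * (r * r)) := by rw [hEtr, mul_assoc]
  simp only [pow_two, mul_add, add_mul, smul_mul_assoc, mul_smul_comm, one_mul, mul_one, mul_assoc,
    map_add, map_smul, smul_eq_mul, hE1, ha0, hr0, h₁, h₂, h₃, h₄, h₅, h₆, h₇]
  ring

end Free

section Product

variable {A : Type*} [Ring A] [StarRing A] [Algebra ℂ A]
  {E : A →ₗ[ℂ] ℂ} {ι : Type*} {x : ι → A}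

theorem prod_mul_mem_wordSpan (hE1 : E 1 = 1) {J : Set ι} {l : List ι} (hl : ∀ i ∈ l, i ∈ J) {w : A}
    (hw : w ∈ wordSpan E x J) : (l.map x).prod * w ∈ wordSpan E x J := by
  induction l with
  | nil => simpa using hw
  | cons i l ih =>
    simp only [List.map_cons, List.prod_cons, mul_assoc]
    exact mul_mem_wordSpan hE1 (hl i (by simp)) (Algebra.subset_adjoin (by simp))
      (ih fun j hj => hl j (List.mem_cons_of_mem _ hj))

theorem star_prod_mul_mem_wordSpan (hE1 : E 1 = 1) {J : Set ι} {l : List ι} (hl : ∀ i ∈ l, i ∈ J)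
    {w : A} (hw : w ∈ wordSpan E x J) : star (l.map x).prod * w ∈ wordSpan E x J := by
  induction l generalizing w with
  | nil => simpa using hw
  | cons i l ih =>
    simp only [List.map_cons, List.prod_cons, star_mul, mul_assoc]
    exact ih (fun j hj => hl j (List.mem_cons_of_mem _ hj))
      (mul_mem_wordSpan hE1 (hl i (by simp)) (Algebra.subset_adjoin (by simp)) hw)

/-- The second and fourth moments of a product of free elements with common second moment `α` and
common fourth moment `β`. -/
theorem FreeFamily.moments_prod (hfree : FreeFamily E x) (hE1 : E 1 = 1)
    (hEtr : ∀ a b : A, E (a * b) = E (b * a)) {α β : ℂ}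
    (hα : ∀ i, E (star (x i) * x i) = α) (hβ : ∀ i, E ((star (x i) * x i) ^ 2) = β)
    {l : List ι} (hl : l.Nodup) :
    E ((l.map x).prod * star (l.map x).prod) = α ^ l.length ∧
      α ^ 2 * E (((l.map x).prod * star (l.map x).prod) ^ 2) =
        α ^ (2 * l.length) * (α ^ 2 + l.length * (β - α ^ 2)) := by
  induction l with
  | nil => simp [hE1]
  | cons i l ih =>
    obtain ⟨hi, hl⟩ := List.nodup_cons.1 hl
    obtain ⟨ih₁, ih₂⟩ := ih hl
    set q := (l.map x).prod with hq
    have hmem : ∀ w ∈ wordSpan E x {j | j ∈ l}, q * star q * w ∈ wordSpan E x {j | j ∈ l} := by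
      intro w hw
      rw [mul_assoc]
      exact prod_mul_mem_wordSpan hE1 (fun _ h => h)
        (star_prod_mul_mem_wordSpan hE1 (fun _ h => h) hw)
    have hb : q * star q ∈ wordSpan E x {j | j ∈ l} := by
      simpa using hmem 1 one_mem_wordSpan
    have ha : star (x i) * x i ∈ Algebra.adjoin ℂ ({x i, star (x i)} : Set A) :=
      mul_mem (Algebra.subset_adjoin (by simp)) (Algebra.subset_adjoin (by simp))
    have h₁ := hfree.apply_mul_of_mem_wordSpan hE1 hi ha hb
    have h₂ := hfree.apply_mul_mul_mul_of_mem_wordSpan hE1 hEtr hi ha hb (hmem _ hb)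
    rw [hα, ih₁] at h₁
    rw [hα, hβ, ih₁] at h₂
    have e₁ : E (x i * q * star (x i * q)) = E (star (x i) * x i * (q * star q)) := by
      rw [star_mul, ← mul_assoc, hEtr _ (star (x i))]
      simp only [mul_assoc]
    have e₂ : E ((x i * q * star (x i * q)) ^ 2) =
        E (star (x i) * x i * (q * star q) * (star (x i) * x i) * (q * star q)) := by
      rw [pow_two, star_mul, ← mul_assoc, ← mul_assoc, hEtr _ (star (x i))]
      simp only [mul_assoc]
    simp only [List.map_cons, List.prod_cons, ← hq, List.length_cons]
    rw [e₁, e₂, h₁, h₂]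
    refine ⟨by ring, ?_⟩
    push_cast
    linear_combination α ^ 2 * ih₂

end Product

/-- A state is dominated by the norm on the positive elements. -/
theorem re_apply_star_mul_self_le {A : Type*} [CStarAlgebra A] {E : A →ₗ[ℂ] ℂ} (hE1 : E 1 = 1)
    (hEpos : ∀ a : A, 0 ≤ E (star a * a)) (a : A) : (E (star a * a)).re ≤ ‖a‖ ^ 2 := by
  let _ : PartialOrder A := CStarAlgebra.spectralOrder A
  have _ : StarOrderedRing A := CStarAlgebra.spectralOrderedRing A
  have h : 0 ≤ algebraMap ℝ A (‖a‖ ^ 2) - star a * a :=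
    sub_nonneg.2 CStarAlgebra.star_mul_le_algebraMap_norm_sq
  obtain ⟨b, hb⟩ := CStarAlgebra.nonneg_iff_eq_star_mul_self.1 h
  have h' := hEpos b
  rw [← hb, map_sub, IsScalarTower.algebraMap_apply ℝ ℂ A, Algebra.algebraMap_eq_smul_one, map_smul,
    hE1, smul_eq_mul, mul_one] at h'
  have h'' := (Complex.le_def.1 h').1
  simp only [Complex.zero_re, Complex.sub_re, Complex.coe_algebraMap, Complex.ofReal_re] at h''
  linarith

theorem rpow_mul_rpow_mul_sqrt_pow_le {v s N M : ℝ} (k : ℕ) (hs : 0 < s) (hN : 0 ≤ N) (hM : 0 ≤ M)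
    (h : s ^ (2 * k) * (s ^ 2 + N * v) ≤ s ^ 2 * M ^ 4) :
    (√v / s) ^ ((1 : ℝ) / 2) * N ^ ((1 : ℝ) / 4) * √s ^ k ≤ M := by
  rcases le_or_gt v 0 with hv | hv
  · rw [Real.sqrt_eq_zero_of_nonpos hv, zero_div, Real.zero_rpow (by norm_num)]
    simpa using hM
  refine le_of_pow_le_pow_left₀ (n := 4) (by norm_num) hM ?_
  have e₁ : ((√v / s) ^ ((1 : ℝ) / 2)) ^ 4 = v / s ^ 2 := by
    rw [← Real.rpow_natCast, ← Real.rpow_mul (by positivity)]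
    norm_num [div_pow, Real.sq_sqrt hv.le]
  have e₂ : (N ^ ((1 : ℝ) / 4)) ^ 4 = N := by
    rw [← Real.rpow_natCast, ← Real.rpow_mul hN]
    norm_num
  have e₃ : (√s ^ k) ^ 4 = s ^ (2 * k) := by
    rw [← pow_mul, show k * 4 = 2 * (2 * k) by ring, pow_mul, Real.sq_sqrt hs.le]
  rw [mul_pow, mul_pow, e₁, e₂, e₃, div_mul_eq_mul_div, div_mul_eq_mul_div,
    div_le_iff₀ (by positivity)]
  have : 0 ≤ s ^ (2 * k) * s ^ 2 := by positivity
  linarith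

/-- Theorem 2(2): for free, identically *-distributed `X 0, …, X n` with
`s² = E(X 0* X 0) > 0` and `γ` the standard deviation of `X 0* X 0 / E(X 0* X 0)`,
the norm of the product of the `n + 1` factors is at least `γ^{1/2} (n+1)^{1/4} s^{n+1}`. -/
theorem norm_prod_ge
    {A : Type*} [CStarAlgebra A]
    (E : A →ₗ[ℂ] ℂ) (hE1 : E 1 = 1)
    (hEpos : ∀ a : A, 0 ≤ E (star a * a))
    (hEtr : ∀ a b : A, E (a * b) = E (b * a))
    (n : ℕ) (X : ℕ → A)
    (hfree : FreeFamily E fun i : Fin (n + 1) => X i)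
    (hid : ∀ i : Fin (n + 1), ∀ w : List Bool, E (wordEval (X i) w) = E (wordEval (X 0) w))
    (hs : 0 < (E (star (X 0) * X 0)).re) :
    (Real.sqrt ((E ((star (X 0) * X 0) ^ 2)).re - (E (star (X 0) * X 0)).re ^ 2) /
          (E (star (X 0) * X 0)).re) ^ ((1 : ℝ) / 2) *
        ((n : ℝ) + 1) ^ ((1 : ℝ) / 4) *
        Real.sqrt ((E (star (X 0) * X 0)).re) ^ (n + 1) ≤
      ‖prodN X (n + 1)‖ := by
  have hα : ∀ i : Fin (n + 1), E (star (X i) * X i) = E (star (X 0) * X 0) := fun i => by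
    simpa [wordEval] using hid i [true, false]
  have hβ : ∀ i : Fin (n + 1),
      E ((star (X i) * X i) ^ 2) = E ((star (X 0) * X 0) ^ 2) := fun i => by
    simpa [wordEval, pow_two, mul_assoc] using hid i [true, false, true, false]
  have hmom := (hfree.moments_prod hE1 hEtr hα hβ (List.nodup_finRange (n + 1))).2
  rw [← List.ofFn_eq_map, List.length_finRange] at hmom
  change _ * E ((prodN X (n + 1) * star (prodN X (n + 1))) ^ 2) = _ at hmom
  set P := prodN X (n + 1)
  obtain ⟨s, hsα⟩ : ∃ s : ℝ, E (star (X 0) * X 0) = s :=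
    ⟨_, (Complex.eq_re_of_ofReal_le (hEpos (X 0)))⟩
  have hnorm : (E ((P * star P) ^ 2)).re ≤ ‖P‖ ^ 4 := by
    have h := re_apply_star_mul_self_le hE1 hEpos (P * star P)
    rw [CStarRing.norm_self_mul_star] at h
    calc (E ((P * star P) ^ 2)).re = (E (star (P * star P) * (P * star P))).re := by
          simp [pow_two]
      _ ≤ (‖P‖ * ‖P‖) ^ 2 := h
      _ = ‖P‖ ^ 4 := by ring
  rw [hsα] at hmom hs ⊢
  rw [Complex.ofReal_re] at hs ⊢
  refine rpow_mul_rpow_mul_sqrt_pow_le (n + 1) hs (by positivity) (norm_nonneg _) ?_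
  have hre := congrArg Complex.re hmom
  have hcast : (s : ℂ) ^ (2 * (n + 1)) * ((s : ℂ) ^ 2 +
      ((n + 1 : ℕ) : ℂ) * (E ((star (X 0) * X 0) ^ 2) - (s : ℂ) ^ 2)) =
      ((s ^ (2 * (n + 1)) : ℝ) : ℂ) * (((s ^ 2 : ℝ) : ℂ) +
      ((n + 1 : ℝ) : ℂ) * (E ((star (X 0) * X 0) ^ 2) - ((s ^ 2 : ℝ) : ℂ))) := by
    push_cast
    ring
  rw [hcast, ← Complex.ofReal_pow, Complex.re_ofReal_mul, Complex.re_ofReal_mul, Complex.add_re,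
    Complex.re_ofReal_mul, Complex.sub_re, Complex.ofReal_re] at hre
  rw [← hre]
  exact mul_le_mul_of_nonneg_left hnorm (by positivity)
end

section
/- Let A, B, C be elements of 𝒜 such that E(A^k) = E(B^k) for all integers k ≥ 1 (A and B are equivalent), the pair (A, C) is free, and the pair (B, C) is free. Then for all integers k ≥ 1: E((A + C)^k) = E((B + C)^k), E((AC)^k) = E((BC)^k), and E((CA)^k) = E((CB)^k). -/
open scoped ComplexOrder

/-- `AlternatingWord K i w` says that `w` is a nonempty product of elements of the sets `K j`,
in which neighbouring factors have different indices and the first factor has index `i`. -/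
inductive AlternatingWord {R ι : Type*} [Mul R] (K : ι → Set R) : ι → R → Prop
  | single {i : ι} {p : R} : p ∈ K i → AlternatingWord K i p
  | cons {i j : ι} {p w : R} : p ∈ K i → i ≠ j → AlternatingWord K j w →
      AlternatingWord K i (p * w)

theorem AlternatingWord.exists_list_prod {R A ι : Type*} [Ring R] [Ring A] {K : ι → Set R}
    {K' : ι → Set A} (f : R →+* A) (hf : ∀ i, ∀ p ∈ K i, f p ∈ K' i) {i : ι} {w : R}
    (hw : AlternatingWord K i w) :
    ∃ (m : ℕ) (k : Fin (m + 1) → ι) (a : Fin (m + 1) → A), k 0 = i ∧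
      (∀ j : Fin m, k j.castSucc ≠ k j.succ) ∧ (∀ j, a j ∈ K' (k j)) ∧
      (List.ofFn a).prod = f w := by
  induction hw with
  | @single i p hp =>
    exact ⟨0, fun _ => i, fun _ => f p, rfl, fun j => j.elim0, fun _ => hf i p hp, by simp⟩
  | @cons i j p w hp hij _ ih =>
    obtain ⟨m, k, a, hk, hne, hmem, hprod⟩ := ih
    refine ⟨m + 1, Fin.cons i k, Fin.cons (f p) a, rfl, fun l => ?_, fun l => ?_, ?_⟩
    · refine Fin.cases ?_ (fun l => ?_) l
      · simpa [hk] using hij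
      · simpa [← Fin.succ_castSucc] using hne l
    · refine Fin.cases ?_ (fun l => ?_) l
      · simpa using hf i p hp
      · simpa using hmem l
    · rw [List.ofFn_succ, List.prod_cons, map_mul, ← hprod]
      simp only [Fin.cons_zero, Fin.cons_succ]

theorem FreeFamily.map_alternatingWord {R A ι : Type*} [Ring R] [Ring A] [StarRing A]
    [Algebra ℂ A] {E : A →ₗ[ℂ] ℂ} {x : ι → A} (hx : FreeFamily E x) {K : ι → Set R}
    (f : R →+* A)
    (hf : ∀ i, ∀ p ∈ K i, f p ∈ Algebra.adjoin ℂ ({x i} : Set A) ∧ E (f p) = 0) {i : ι} {w : R}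
    (hw : AlternatingWord K i w) : E (f w) = 0 := by
  obtain ⟨m, k, a, -, hne, hmem, hprod⟩ := hw.exists_list_prod
    (K' := fun i => {p | p ∈ Algebra.adjoin ℂ ({x i} : Set A) ∧ E p = 0}) f hf
  rw [← hprod]
  exact hx m k hne a (fun j => Algebra.adjoin_mono (by simp) (hmem j).1) fun j => (hmem j).2

/-- If every element of the algebra generated by `z i` is a scalar plus an element of `K i`, then
the algebra generated by all the `z i` is spanned by `1` and the alternating words in the `K i`. -/
theorem adjoin_range_le_span_alternatingWord {R ι : Type*} [Ring R] [Algebra ℂ R] (z : ι → R)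
    (K : ι → Set R) (hK : ∀ i, ∀ p ∈ K i, p ∈ Algebra.adjoin ℂ ({z i} : Set R))
    (hc : ∀ i, ∀ p ∈ Algebra.adjoin ℂ ({z i} : Set R), ∃ t : ℂ, p - t • 1 ∈ K i) :
    Subalgebra.toSubmodule (Algebra.adjoin ℂ (Set.range z)) ≤
      Submodule.span ℂ ({1} ∪ {w | ∃ i, AlternatingWord K i w}) := by
  set S : Submodule ℂ R := Submodule.span ℂ ({1} ∪ {w | ∃ i, AlternatingWord K i w}) with hS
  have one_mem : (1 : R) ∈ S := Submodule.subset_span (by simp)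
  have word_mem {i : ι} {w : R} (hw : AlternatingWord K i w) : w ∈ S :=
    Submodule.subset_span (Or.inr ⟨i, hw⟩)
  have poly_mem {i : ι} {p : R} (hp : p ∈ Algebra.adjoin ℂ ({z i} : Set R)) : p ∈ S := by
    obtain ⟨t, ht⟩ := hc i p hp
    simpa using S.add_mem (word_mem (.single ht)) (S.smul_mem t one_mem)
  have poly_mul_mem {i j : ι} {p w : R} (hp : p ∈ Algebra.adjoin ℂ ({z i} : Set R))
      (hij : i ≠ j) (hw : AlternatingWord K j w) : p * w ∈ S := by
    obtain ⟨t, ht⟩ := hc i p hp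
    simpa [sub_mul] using S.add_mem (word_mem (.cons ht hij hw)) (S.smul_mem t (word_mem hw))
  have gen_mem (i : ι) : z i ∈ Algebra.adjoin ℂ ({z i} : Set R) :=
    Algebra.self_mem_adjoin_singleton ℂ (z i)
  have gen_mul_mem (i : ι) {w : R} (hw : w ∈ S) : z i * w ∈ S := by
    induction hw using Submodule.span_induction with
    | mem w hw =>
      rcases hw with rfl | ⟨j, hw⟩
      · simpa using poly_mem (gen_mem i)
      · by_cases hij : i = j
        · subst hij
          cases hw with
          | single hp => exact poly_mem (mul_mem (gen_mem i) (hK i _ hp))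
          | cons hp hij hw =>
            rw [← mul_assoc]
            exact poly_mul_mem (mul_mem (gen_mem i) (hK i _ hp)) hij hw
        · exact poly_mul_mem (gen_mem i) hij hw
    | zero => simp
    | add u v _ _ hu hv => simpa [mul_add] using S.add_mem hu hv
    | smul t u _ hu => simpa using S.smul_mem t hu
  have mul_mem_span {p : R} (hp : p ∈ Algebra.adjoin ℂ (Set.range z)) :
      ∀ w ∈ S, p * w ∈ S := by
    induction hp using Algebra.adjoin_induction with
    | mem p hp =>
      obtain ⟨i, rfl⟩ := hp
      exact fun w hw => gen_mul_mem i hw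
    | algebraMap t =>
      intro w hw
      simpa [Algebra.algebraMap_eq_smul_one] using S.smul_mem t hw
    | add p q _ _ hp hq =>
      intro w hw
      simpa [add_mul] using S.add_mem (hp w hw) (hq w hw)
    | mul p q _ _ hp hq =>
      intro w hw
      simpa [mul_assoc] using hp _ (hq w hw)
  intro p hp
  simpa using mul_mem_span hp 1 one_mem

/-- The joint moments of a free family are determined by the moments of its members. -/
theorem FreeFamily.map_fst_eq_map_snd {A B ι : Type*} [Ring A] [StarRing A] [Algebra ℂ A]
    [Ring B] [StarRing B] [Algebra ℂ B] {E : A →ₗ[ℂ] ℂ} {F : B →ₗ[ℂ] ℂ} {x : ι → A} {y : ι → B}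
    (hx : FreeFamily E x) (hy : FreeFamily F y) (hE : E 1 = 1) (hF : F 1 = 1)
    (hxy : ∀ i, ∀ k : ℕ, E (x i ^ k) = F (y i ^ k)) {p : A × B}
    (hp : p ∈ Algebra.adjoin ℂ (Set.range fun i => (x i, y i))) : E p.1 = F p.2 := by
  have eq_of_mem (i : ι) {q : A × B}
      (hq : q ∈ Algebra.adjoin ℂ ({(x i, y i)} : Set (A × B))) : E q.1 = F q.2 := by
    rw [← Subalgebra.mem_toSubmodule, Algebra.adjoin_eq_span] at hq
    induction hq using Submodule.span_induction with
    | mem q hq =>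
      obtain ⟨k, rfl⟩ := Submonoid.mem_closure_singleton.1 hq
      exact hxy i k
    | zero => simp
    | add u v _ _ hu hv => simp [hu, hv]
    | smul t u _ hu => simp [hu]
  have fst_mem (i : ι) {q : A × B} (hq : q ∈ Algebra.adjoin ℂ ({(x i, y i)} : Set (A × B))) :
      q.1 ∈ Algebra.adjoin ℂ ({x i} : Set A) := by
    have h := Subalgebra.mem_map.2 ⟨q, hq, (rfl : AlgHom.fst ℂ A B q = _)⟩
    simpa [AlgHom.map_adjoin] using h
  have snd_mem (i : ι) {q : A × B} (hq : q ∈ Algebra.adjoin ℂ ({(x i, y i)} : Set (A × B))) :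
      q.2 ∈ Algebra.adjoin ℂ ({y i} : Set B) := by
    have h := Subalgebra.mem_map.2 ⟨q, hq, (rfl : AlgHom.snd ℂ A B q = _)⟩
    simpa [AlgHom.map_adjoin] using h
  have hspan := adjoin_range_le_span_alternatingWord (fun i => (x i, y i))
    (fun i => {q | q ∈ Algebra.adjoin ℂ ({(x i, y i)} : Set (A × B)) ∧ E q.1 = 0 ∧ F q.2 = 0})
    (fun _ _ h => h.1)
    (fun i q hq => ⟨E q.1, sub_mem hq (Subalgebra.smul_mem _ (one_mem _) _), by simp [hE],
      by simp [hF, eq_of_mem i hq]⟩) hp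
  clear hp
  induction hspan using Submodule.span_induction with
  | mem w hw =>
    rcases hw with rfl | ⟨i, hw⟩
    · simp [hE, hF]
    · have h₁ := hx.map_alternatingWord (RingHom.fst A B)
        (fun i q hq => ⟨fst_mem i hq.1, hq.2.1⟩) hw
      have h₂ := hy.map_alternatingWord (RingHom.snd A B)
        (fun i q hq => ⟨snd_mem i hq.1, hq.2.2⟩) hw
      exact h₁.trans h₂.symm
  | zero => simp
  | add u v _ _ hu hv => simp [hu, hv]
  | smul t u _ hu => simp [hu]

/-- If `a` and `b` have the same moments, `(a, c)` is free and `(b, c)` is free, then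
`a + c ∼ b + c`, `a c ∼ b c` and `c a ∼ c b` (equality of all moments). -/
theorem equivalence_of_products
    {A : Type*} [CStarAlgebra A]
    (E : A →ₗ[ℂ] ℂ) (hE1 : E 1 = 1)
    (hEpos : ∀ x : A, 0 ≤ E (star x * x))
    (hEtr : ∀ x y : A, E (x * y) = E (y * x))
    (a b c : A)
    (hab : ∀ k : ℕ, 1 ≤ k → E (a ^ k) = E (b ^ k))
    (hac : FreeFamily E ![a, c])
    (hbc : FreeFamily E ![b, c]) :
    ∀ k : ℕ, 1 ≤ k →
      E ((a + c) ^ k) = E ((b + c) ^ k) ∧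
      E ((a * c) ^ k) = E ((b * c) ^ k) ∧
      E ((c * a) ^ k) = E ((c * b) ^ k) := by
  have moments (i : Fin 2) (k : ℕ) : E (![a, c] i ^ k) = E (![b, c] i ^ k) := by
    rcases Nat.eq_zero_or_pos k with rfl | hk
    · simp
    · fin_cases i
      · exact hab k hk
      · rfl
  have joint {p : A × A} := hac.map_fst_eq_map_snd hbc hE1 hE1 moments (p := p)
  have mem_ab : (a, b) ∈ Algebra.adjoin ℂ (Set.range fun i => (![a, c] i, ![b, c] i)) :=
    Algebra.subset_adjoin ⟨0, rfl⟩
  have mem_cc : (c, c) ∈ Algebra.adjoin ℂ (Set.range fun i => (![a, c] i, ![b, c] i)) :=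
    Algebra.subset_adjoin ⟨1, rfl⟩
  exact fun k _ => ⟨joint (pow_mem (add_mem mem_ab mem_cc) k),
    joint (pow_mem (mul_mem mem_ab mem_cc) k), joint (pow_mem (mul_mem mem_cc mem_ab) k)⟩
end

section
/- Let X_1, …, X_n be free elements of 𝒜 (not necessarily self-adjoint) and set Π_n := X_1 X_2 ⋯ X_n. Then Π_n* Π_n is equivalent to the product X_n* X_n · X_{n−1}* X_{n−1} ⋯ X_1* X_1, i.e. for every integer k ≥ 1, E((Π_n* Π_n)^k) = E((X_n* X_n · X_{n−1}* X_{n−1} ⋯ X_1* X_1)^k). -/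
open scoped ComplexOrder

/-- The product of the letters of a word whose letters are labelled by indices. -/
def labelledProd {ι A : Type*} [Monoid A] (w : List (ι × A)) : A :=
  (w.map Prod.snd).prod

/-- A word is reduced when neighbouring letters have distinct labels and every letter is a
centered element of the subalgebra named by its label. -/
structure IsReducedWord_s18 {ι A : Type*} [Ring A] [Algebra ℂ A] (E : A →ₗ[ℂ] ℂ)
    (P : ι → Subalgebra ℂ A) (w : List (ι × A)) : Prop where
  isChain : w.IsChain (fun p q => p.1 ≠ q.1)
  mem : ∀ p ∈ w, p.2 ∈ P p.1
  centered : ∀ p ∈ w, E p.2 = 0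

/-- A family of subalgebras is free when `E` vanishes on all nonempty reduced words. -/
def FreeSubalgebras {ι A : Type*} [Ring A] [Algebra ℂ A] (E : A →ₗ[ℂ] ℂ)
    (P : ι → Subalgebra ℂ A) : Prop :=
  ∀ w, IsReducedWord_s18 E P w → w ≠ [] → E (labelledProd w) = 0

@[simp]
lemma labelledProd_nil {ι A : Type*} [Monoid A] : labelledProd ([] : List (ι × A)) = 1 := by
  simp [labelledProd]

@[simp]
lemma labelledProd_cons {ι A : Type*} [Monoid A] (p : ι × A) (w : List (ι × A)) :
    labelledProd (p :: w) = p.2 * labelledProd w := by simp [labelledProd]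

@[simp]
lemma labelledProd_append {ι A : Type*} [Monoid A] (v w : List (ι × A)) :
    labelledProd (v ++ w) = labelledProd v * labelledProd w := by simp [labelledProd]

section

variable {ι κ A R : Type*} [Ring A] [Algebra ℂ A] [Ring R] [Algebra ℂ R]

lemma IsReducedWord_s18.nil (E : A →ₗ[ℂ] ℂ) (P : ι → Subalgebra ℂ A) : IsReducedWord_s18 E P [] :=
  ⟨by simp, by simp, by simp⟩

lemma IsReducedWord_s18.tail {E : A →ₗ[ℂ] ℂ} {P : ι → Subalgebra ℂ A} {p : ι × A}
    {w : List (ι × A)} (h : IsReducedWord_s18 E P (p :: w)) : IsReducedWord_s18 E P w :=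
  ⟨h.isChain.tail, fun q hq => h.mem q (by simp [hq]), fun q hq => h.centered q (by simp [hq])⟩

lemma IsReducedWord_s18.cons {E : A →ₗ[ℂ] ℂ} {P : ι → Subalgebra ℂ A} {p : ι × A}
    {w : List (ι × A)} (h : IsReducedWord_s18 E P w) (hp : p.2 ∈ P p.1) (hE : E p.2 = 0)
    (hne : ∀ q ∈ w.head?, p.1 ≠ q.1) : IsReducedWord_s18 E P (p :: w) where
  isChain := List.isChain_cons.2 ⟨hne, h.isChain⟩
  mem := by simpa using ⟨hp, fun a b hab => h.mem (a, b) hab⟩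
  centered := by simpa using ⟨hE, fun a b hab => h.centered (a, b) hab⟩

lemma IsReducedWord_s18.append {E : A →ₗ[ℂ] ℂ} {P : ι → Subalgebra ℂ A}
    {v w : List (ι × A)} (hv : IsReducedWord_s18 E P v) (hw : IsReducedWord_s18 E P w)
    (hne : ∀ p ∈ v.getLast?, ∀ q ∈ w.head?, p.1 ≠ q.1) : IsReducedWord_s18 E P (v ++ w) where
  isChain := List.isChain_append.2 ⟨hv.isChain, hw.isChain, hne⟩
  mem p hp := (List.mem_append.1 hp).elim (hv.mem p) (hw.mem p)
  centered p hp := (List.mem_append.1 hp).elim (hv.centered p) (hw.centered p)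

/-- The values of the reduced words with labels in `s`. -/
def reducedValues (E : A →ₗ[ℂ] ℂ) (P : ι → Subalgebra ℂ A) (s : Set ι) : Set A :=
  {x | ∃ w, IsReducedWord_s18 E P w ∧ (∀ p ∈ w, p.1 ∈ s) ∧ labelledProd w = x}

lemma cons_mem_span_reducedValues {E : A →ₗ[ℂ] ℂ} (hE1 : E 1 = 1) {P : ι → Subalgebra ℂ A}
    {s : Set ι} {i : ι} (hi : i ∈ s) {a : A} (ha : a ∈ P i) {w : List (ι × A)}
    (hw : IsReducedWord_s18 E P w) (hs : ∀ p ∈ w, p.1 ∈ s) (hne : ∀ q ∈ w.head?, i ≠ q.1) :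
    a * labelledProd w ∈ Submodule.span ℂ (reducedValues E P s) := by
  have key : a * labelledProd w =
      E a • labelledProd w + (a - algebraMap ℂ A (E a)) * labelledProd w := by
    rw [sub_mul, Algebra.smul_def]; abel
  rw [key]
  refine add_mem (Submodule.smul_mem _ _ (Submodule.subset_span ⟨w, hw, hs, rfl⟩))
    (Submodule.subset_span ⟨(i, a - algebraMap ℂ A (E a)) :: w, ?_, ?_, by simp⟩)
  · exact hw.cons (sub_mem ha (algebraMap_mem _ _)) (by simp [Algebra.algebraMap_eq_smul_one, hE1])
      hne
  · simpa using ⟨hi, fun a b hab => hs (a, b) hab⟩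

lemma mul_mem_span_reducedValues {E : A →ₗ[ℂ] ℂ} (hE1 : E 1 = 1) {P : ι → Subalgebra ℂ A}
    {s : Set ι} {i : ι} (hi : i ∈ s) {a : A} (ha : a ∈ P i) {x : A}
    (hx : x ∈ Submodule.span ℂ (reducedValues E P s)) :
    a * x ∈ Submodule.span ℂ (reducedValues E P s) := by
  induction hx using Submodule.span_induction with
  | zero => simp
  | add x y _ _ hx hy => rw [mul_add]; exact add_mem hx hy
  | smul c x _ hx => rw [mul_smul_comm]; exact Submodule.smul_mem _ _ hx
  | mem x hx =>
    obtain ⟨w, hw, hs, rfl⟩ := hx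
    by_cases hne : ∀ q ∈ w.head?, i ≠ q.1
    · exact cons_mem_span_reducedValues hE1 hi ha hw hs hne
    · match w with
      | [] => simp at hne
      | (j, b) :: w =>
        obtain rfl : i = j := by simpa using hne
        rw [labelledProd_cons, ← mul_assoc]
        exact cons_mem_span_reducedValues hE1 hi (mul_mem ha (hw.mem _ List.mem_cons_self)) hw.tail
          (fun p hp => hs p (by simp [hp])) (List.isChain_cons.1 hw.isChain).1

/-- The algebra generated by a family of subalgebras is spanned by the reduced words. -/
lemma mem_span_reducedValues {E : A →ₗ[ℂ] ℂ} (hE1 : E 1 = 1) {P : ι → Subalgebra ℂ A}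
    {s : Set ι} {x : A} (hx : x ∈ ⨆ i ∈ s, P i) :
    x ∈ Submodule.span ℂ (reducedValues E P s) := by
  let S : Subalgebra ℂ A :=
    { carrier := {x | ∀ y ∈ Submodule.span ℂ (reducedValues E P s),
        x * y ∈ Submodule.span ℂ (reducedValues E P s)}
      mul_mem' := fun ha hb y hy => by rw [mul_assoc]; exact ha _ (hb _ hy)
      add_mem' := fun ha hb y hy => by rw [add_mul]; exact add_mem (ha _ hy) (hb _ hy)
      algebraMap_mem' := fun c y hy => by
        rw [← Algebra.smul_def]; exact Submodule.smul_mem _ _ hy }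
  have hS : ⨆ i ∈ s, P i ≤ S :=
    iSup₂_le fun i hi a ha y hy => mul_mem_span_reducedValues hE1 hi ha hy
  simpa using hS hx 1 (Submodule.subset_span ⟨[], .nil E P, by simp, by simp⟩)

/-- A centered element of the algebra generated by free subalgebras is a combination of nonempty
reduced words. -/
lemma FreeSubalgebras.mem_span_of_centered {E : A →ₗ[ℂ] ℂ} (hE1 : E 1 = 1)
    {P : ι → Subalgebra ℂ A} (hP : FreeSubalgebras E P) {s : Set ι} {x : A}
    (hx : x ∈ ⨆ i ∈ s, P i) (h0 : E x = 0) :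
    x ∈ Submodule.span ℂ
      {x | ∃ w, IsReducedWord_s18 E P w ∧ w ≠ [] ∧ (∀ p ∈ w, p.1 ∈ s) ∧ labelledProd w = x} := by
  set N : Set A :=
    {x | ∃ w, IsReducedWord_s18 E P w ∧ w ≠ [] ∧ (∀ p ∈ w, p.1 ∈ s) ∧ labelledProd w = x}
  have hsub : reducedValues E P s ⊆ insert 1 N := by
    rintro _ ⟨w, hw, hs, rfl⟩
    by_cases h : w = []
    · simp [h]
    · exact Or.inr ⟨w, hw, h, hs, rfl⟩
  have hN : Submodule.span ℂ N ≤ LinearMap.ker E := by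
    rw [Submodule.span_le]
    rintro _ ⟨w, hw, h, -, rfl⟩
    exact hP w hw h
  obtain ⟨c, z, hz, rfl⟩ := Submodule.mem_span_insert.1
    (Submodule.span_mono hsub (mem_span_reducedValues hE1 hx))
  have hc : c = 0 := by
    have hEz : E z = 0 := hN hz
    simpa [hE1, hEz] using h0
  simpa [hc] using hz

/-- Grouping free subalgebras along `c : ι → κ` yields free subalgebras. -/
lemma FreeSubalgebras.iSup_fiber {E : A →ₗ[ℂ] ℂ} (hE1 : E 1 = 1) {P : ι → Subalgebra ℂ A}
    (hP : FreeSubalgebras E P) (c : ι → κ) :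
    FreeSubalgebras E (fun k => ⨆ i ∈ {i | c i = k}, P i) := by
  have key : ∀ L, IsReducedWord_s18 E (fun k => ⨆ i ∈ {i | c i = k}, P i) L →
      labelledProd L ∈ Submodule.span ℂ {x | ∃ w, IsReducedWord_s18 E P w ∧
        w.head?.map (fun p => c p.1) = L.head?.map Prod.fst ∧ labelledProd w = x} := by
    intro L
    induction L with
    | nil => exact fun _ => Submodule.subset_span ⟨[], .nil E P, by simp, by simp⟩
    | cons p L ih =>
      intro hL
      have hp := hP.mem_span_of_centered hE1 (hL.mem p List.mem_cons_self)
        (hL.centered p List.mem_cons_self)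
      rw [labelledProd_cons]
      refine (Submodule.mul_le (P := Submodule.span ℂ _)).1 ?_ _ hp _ (ih hL.tail)
      rw [Submodule.span_mul_span]
      refine Submodule.span_mono ?_
      rintro _ ⟨_, ⟨v, hv, hv0, hvs, rfl⟩, _, ⟨w, hw, hwL, rfl⟩, rfl⟩
      refine ⟨v ++ w, hv.append hw ?_, ?_, by simp⟩
      · intro a ha b hb hab
        have hac : c a.1 = p.1 := hvs a (List.mem_of_getLast? ha)
        rw [Option.mem_def.1 hb] at hwL
        obtain ⟨q, hq, hqb⟩ := Option.map_eq_some_iff.1 hwL.symm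
        exact (List.isChain_cons.1 hL.isChain).1 q hq (by rw [← hac, hab, hqb])
      · match v, hv0 with
        | a :: v, _ => simpa using hvs a List.mem_cons_self
  intro L hL hL0
  have hker : Submodule.span ℂ {x | ∃ w, IsReducedWord_s18 E P w ∧
      w.head?.map (fun p => c p.1) = L.head?.map Prod.fst ∧ labelledProd w = x} ≤
      LinearMap.ker E := by
    rw [Submodule.span_le]
    rintro _ ⟨w, hw, hwL, rfl⟩
    refine hP w hw ?_
    rintro rfl
    simp [hL0] at hwL
  exact hker (key L hL)

lemma FreeSubalgebras.comp {E : A →ₗ[ℂ] ℂ} {P : κ → Subalgebra ℂ A}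
    (hP : FreeSubalgebras E P) {f : ι → κ} (hf : Function.Injective f) :
    FreeSubalgebras E (P ∘ f) := by
  intro w hw hw0
  have := hP (w.map (Prod.map f id)) ⟨?_, ?_, ?_⟩ (by simpa using hw0)
  · simpa [labelledProd, Function.comp_def] using this
  · exact (List.isChain_map _).2 (hw.isChain.imp fun a b h => hf.ne h)
  · intro p hp
    obtain ⟨q, hq, rfl⟩ := List.mem_map.1 hp
    exact hw.mem q hq
  · intro p hp
    obtain ⟨q, hq, rfl⟩ := List.mem_map.1 hp
    exact hw.centered q hq

/-- Two homomorphisms into an algebra that map generating subalgebras into free subalgebras with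
the same distribution have the same joint distribution. -/
lemma FreeSubalgebras.eq_of_eqOn {E : A →ₗ[ℂ] ℂ} (hE1 : E 1 = 1) {P : ι → Subalgebra ℂ A}
    (hP : FreeSubalgebras E P) {Q : ι → Subalgebra ℂ R} (hQ : ⨆ i, Q i = ⊤)
    {φ ψ : R →ₐ[ℂ] A} (hφ : ∀ i, ∀ r ∈ Q i, φ r ∈ P i) (hψ : ∀ i, ∀ r ∈ Q i, ψ r ∈ P i)
    (h : ∀ i, ∀ r ∈ Q i, E (φ r) = E (ψ r)) (r : R) : E (φ r) = E (ψ r) := by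
  have vanish : ∀ χ : R →ₐ[ℂ] A, (∀ i, ∀ r ∈ Q i, χ r ∈ P i) →
      ∀ w, IsReducedWord_s18 (E ∘ₗ χ.toLinearMap) Q w → w ≠ [] → E (χ (labelledProd w)) = 0 := by
    intro χ hχ w hw hw0
    have := hP (w.map (Prod.map id χ)) ⟨?_, ?_, ?_⟩ (by simpa using hw0)
    · simpa [labelledProd, map_list_prod, Function.comp_def] using this
    · exact (List.isChain_map _).2 hw.isChain
    · intro p hp
      obtain ⟨q, hq, rfl⟩ := List.mem_map.1 hp
      exact hχ _ _ (hw.mem q hq)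
    · intro p hp
      obtain ⟨q, hq, rfl⟩ := List.mem_map.1 hp
      exact hw.centered q hq
  have hr : r ∈ Submodule.span ℂ (reducedValues (E ∘ₗ φ.toLinearMap) Q Set.univ) :=
    mem_span_reducedValues (by simp [hE1]) (by simp [hQ])
  induction hr using Submodule.span_induction with
  | zero => simp
  | add x y _ _ hx hy => simp [hx, hy]
  | smul c x _ hx => simp [hx]
  | mem x hx =>
    obtain ⟨w, hw, -, rfl⟩ := hx
    by_cases hw0 : w = []
    · simp [hw0]
    · rw [vanish φ hφ w hw hw0, vanish ψ hψ w ⟨hw.isChain, hw.mem, fun p hp => ?_⟩ hw0]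
      exact (h _ _ (hw.mem p hp)).symm.trans (hw.centered p hp)

/-- Multiplying by a free element depends only on the moments. -/
lemma FreeSubalgebras.moments_mul_congr {E : A →ₗ[ℂ] ℂ} (hE1 : E 1 = 1)
    {P : Bool → Subalgebra ℂ A} (hP : FreeSubalgebras E P) {a b c : A} (ha : a ∈ P false)
    (hb : b ∈ P true) (hc : c ∈ P true) (hbc : ∀ k : ℕ, E (b ^ k) = E (c ^ k)) (k : ℕ) :
    E ((b * a) ^ k) = E ((c * a) ^ k) := by
  let Q : Bool → Subalgebra ℂ (FreeAlgebra ℂ Bool) :=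
    fun i => Algebra.adjoin ℂ {FreeAlgebra.ι ℂ i}
  let φ : A → FreeAlgebra ℂ Bool →ₐ[ℂ] A :=
    fun b => FreeAlgebra.lift ℂ (fun i => bif i then b else a)
  have hQ : ⨆ i, Q i = ⊤ := by
    rw [eq_top_iff, ← FreeAlgebra.adjoin_range_ι, Algebra.adjoin_le_iff]
    rintro _ ⟨i, rfl⟩
    exact le_iSup Q i (Algebra.self_mem_adjoin_singleton ℂ _)
  have hφ : ∀ b ∈ P true, ∀ i, ∀ r ∈ Q i, φ b r ∈ P i := by
    intro b hb i
    suffices Q i ≤ (P i).comap (φ b) from this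
    rw [Algebra.adjoin_le_iff, Set.singleton_subset_iff]
    cases i <;> simpa [φ]
  have hE : ∀ i, ∀ r ∈ Q i, E (φ b r) = E (φ c r) := by
    intro i r hr
    obtain ⟨f, rfl⟩ := (Algebra.adjoin_singleton_eq_range_aeval ℂ (FreeAlgebra.ι ℂ i)).le hr
    rw [AlgHom.toRingHom_eq_coe, RingHom.coe_coe, ← Polynomial.aeval_algHom_apply (φ b),
      ← Polynomial.aeval_algHom_apply (φ c)]
    cases i
    · simp [φ]
    · simp [φ, Polynomial.aeval_eq_sum_range, hbc]
  simpa [φ] using hP.eq_of_eqOn hE1 hQ (hφ b hb) (hφ c hc) hE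
    ((FreeAlgebra.ι ℂ true * FreeAlgebra.ι ℂ false) ^ k)

lemma trace_mul_pow_comm {E : A →ₗ[ℂ] ℂ} (hEtr : ∀ x y : A, E (x * y) = E (y * x)) (x y : A)
    (k : ℕ) : E ((x * y) ^ k) = E ((y * x) ^ k) := by
  cases k with
  | zero => simp
  | succ k =>
    have hcomm : ∀ k : ℕ, (x * y) ^ k * x = x * (y * x) ^ k := fun k => by
      induction k with
      | zero => simp
      | succ k ih => rw [pow_succ', mul_assoc, ih, pow_succ']; simp only [mul_assoc]
    rw [pow_succ, ← mul_assoc, hcomm, mul_assoc, hEtr, mul_assoc, ← pow_succ]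

lemma FreeFamily.freeSubalgebras [StarRing A] {E : A →ₗ[ℂ] ℂ} {x : ι → A}
    (h : FreeFamily E x) :
    FreeSubalgebras E (fun i => Algebra.adjoin ℂ ({x i, star (x i)} : Set A)) := by
  intro w hw hw0
  obtain ⟨m, hm⟩ := Nat.exists_eq_succ_of_ne_zero (mt List.length_eq_zero_iff.1 hw0)
  obtain ⟨f, rfl⟩ : ∃ f : Fin (m + 1) → ι × A, w = List.ofFn f :=
    ⟨fun i => w.get (i.cast hm.symm), List.ext_get (by simp [hm]) fun _ _ _ => by
      rw [List.get_ofFn]; rfl⟩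
  have := h m (fun i => (f i).1) (fun j => ?_) (fun i => (f i).2)
    (fun j => hw.mem (f j) (List.mem_ofFn.2 ⟨j, rfl⟩))
    (fun j => hw.centered (f j) (List.mem_ofFn.2 ⟨j, rfl⟩))
  · simpa [labelledProd, List.map_ofFn, Function.comp_def] using this
  · have := List.isChain_iff_getElem.1 hw.isChain j (by simp)
    rwa [List.getElem_ofFn, List.getElem_ofFn] at this

lemma list_prod_mem_and_star_mem [StarRing A] (S : Subalgebra ℂ A) (l : List A)
    (hl : ∀ x ∈ l, x ∈ S ∧ star x ∈ S) : l.prod ∈ S ∧ star l.prod ∈ S := by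
  induction l with
  | nil => simp [one_mem]
  | cons a l ih =>
    have h := ih fun x hx => hl x (by simp [hx])
    have ha := hl a (by simp)
    simpa using ⟨mul_mem ha.1 h.1, mul_mem h.2 ha.2⟩

lemma moments_star_prod_mul_prod [StarRing A] {E : A →ₗ[ℂ] ℂ} (hE1 : E 1 = 1)
    (hEtr : ∀ x y : A, E (x * y) = E (y * x)) (n : ℕ) (X : Fin n → A)
    (hX : FreeSubalgebras E fun i => Algebra.adjoin ℂ ({X i, star (X i)} : Set A)) (k : ℕ) :
    E ((star (List.ofFn X).prod * (List.ofFn X).prod) ^ k) =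
      E ((List.ofFn fun i : Fin n => star (X i.rev) * X i.rev).prod ^ k) := by
  induction n generalizing k with
  | zero => simp
  | succ n ih =>
    have hmoments := ih (fun i => X i.succ) (hX.comp (Fin.succ_injective n))
    let c : Fin (n + 1) → Bool := fun i => decide (i ≠ 0)
    have hfree := hX.iSup_fiber hE1 c
    set S : Bool → Subalgebra ℂ A := fun k =>
      ⨆ i ∈ {i | c i = k},
        Algebra.adjoin ℂ ({X i, star (X i)} : Set A)
    have hle : ∀ i, Algebra.adjoin ℂ ({X i, star (X i)} : Set A) ≤
        S (c i) := fun i =>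
      le_iSup₂_of_le i rfl le_rfl
    have hmem : ∀ i, X i ∈ S (c i) ∧
        star (X i) ∈ S (c i) := fun i =>
      ⟨hle i (Algebra.subset_adjoin (by simp)), hle i (Algebra.subset_adjoin (by simp))⟩
    have hmem0 : X 0 ∈ S false ∧ star (X 0) ∈ S false := by simpa [c] using hmem 0
    have hmem_succ : ∀ i : Fin n, X i.succ ∈ S true ∧ star (X i.succ) ∈ S true := fun i => by
      simpa [c] using hmem i.succ
    have hy := list_prod_mem_and_star_mem (S true) (List.ofFn fun i => X i.succ) (by
      simpa [List.mem_ofFn] using hmem_succ)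
    have hB : (List.ofFn fun i : Fin n => star (X i.rev.succ) * X i.rev.succ).prod ∈ S true :=
      list_prod_mem (by
        simpa [List.mem_ofFn] using fun i : Fin n =>
          mul_mem (hmem_succ i.rev).2 (hmem_succ i.rev).1)
    have hrev : (List.ofFn fun i : Fin (n + 1) => star (X i.rev) * X i.rev).prod =
        (List.ofFn fun i : Fin n => star (X i.rev.succ) * X i.rev.succ).prod *
          (star (X 0) * X 0) := by
      rw [List.ofFn_succ']
      simp [Fin.rev_castSucc]
    rw [hrev, List.ofFn_succ, List.prod_cons]
    set y := (List.ofFn fun i => X i.succ).prod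
    calc E ((star (X 0 * y) * (X 0 * y)) ^ k)
        = E ((star y * (star (X 0) * X 0 * y)) ^ k) := by simp only [star_mul, mul_assoc]
      _ = E ((y * star y * (star (X 0) * X 0)) ^ k) := by
        rw [trace_mul_pow_comm hEtr, mul_assoc, trace_mul_pow_comm hEtr]
      _ = _ := hfree.moments_mul_congr hE1 (mul_mem hmem0.2 hmem0.1) (mul_mem hy.1 hy.2) hB
        (fun j => (trace_mul_pow_comm hEtr _ _ j).trans (hmoments j)) k

end

/-- For free `X 0, …, X (n-1)` with product `Π = X 0 ⋯ X (n-1)`, the element `Π* Π`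
has the same moments as `(X (n-1))* X (n-1) ⋯ (X 0)* X 0`. -/
theorem prod_star_prod_equivalent
    {A : Type*} [CStarAlgebra A]
    (E : A →ₗ[ℂ] ℂ) (hE1 : E 1 = 1)
    (hEpos : ∀ x : A, 0 ≤ E (star x * x))
    (hEtr : ∀ x y : A, E (x * y) = E (y * x))
    (n : ℕ) (X : Fin n → A)
    (hfree : FreeFamily E X) :
    ∀ k : ℕ, 1 ≤ k →
      E ((star (List.ofFn X).prod * (List.ofFn X).prod) ^ k) =
        E ((List.ofFn fun i : Fin n => star (X i.rev) * X i.rev).prod ^ k) := by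
  exact fun k _ => moments_star_prod_mul_prod hE1 hEtr n X hfree.freeSubalgebras k
end
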